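/- arXiv:2305.20043 — 2 statements merged into one kernel-verified Lean document; each statement's English description precedes it below -/
import Mathlib

section
/- When the adversarial missingness mechanism is constructed by generalized rejection sampling with Σ_{r ≠ 0} p_R(r) > 0 and p_α strictly positive, the adversarial pmf p_α is a global maximizer of the modeler's objective: J(p_α) ≥ J(θ) for every strictly positive pmf θ on X. -/
open Finset

noncomputable section

namespace AM

/-- A mask: `r i = true` means coordinate `i` is observed. -/
abbrev Mask (d : ℕ) := Fin d → Bool

/-- The all-missing mask. -/
def zeroMask (d : ℕ) : Mask d := fun _ => false

variable {d : ℕ} {α : Fin d → Type*} [∀ i, Fintype (α i)] [∀ i, DecidableEq (α i)]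
  [∀ i, Nonempty (α i)]

/-- Restriction of a sample to the observed coordinates of a mask. -/
def restr (r : Mask d) (x : ∀ i, α i) : ∀ i : {i : Fin d // r i = true}, α i.1 :=
  fun i => x i.1

/-- Observed marginal of a pmf under mask `r`. -/
def obsMarg (p : (∀ i, α i) → ℝ) (r : Mask d)
    (xo : ∀ i : {i : Fin d // r i = true}, α i.1) : ℝ :=
  ∑ x : ∀ i, α i, if restr r x = xo then p x else 0

/-- Marginal pmf of the mask under missingness mechanism `q`. -/
def maskMarg (p : (∀ i, α i) → ℝ) (q : Mask d → (∀ i, α i) → ℝ) (r : Mask d) : ℝ :=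
  ∑ x : ∀ i, α i, p x * q r x

/-- Conditional pmf of the observed part given the mask: `P(X_o = x_o | R = r)`. -/
def condObs (p : (∀ i, α i) → ℝ) (q : Mask d → (∀ i, α i) → ℝ) (r : Mask d)
    (xo : ∀ i : {i : Fin d // r i = true}, α i.1) : ℝ :=
  (∑ x : ∀ i, α i, if restr r x = xo then p x * q r x else 0) / maskMarg p q r

/-- The number of missing coordinates of a mask. -/
def missCount {d : ℕ} (r : Mask d) : ℕ := (univ.filter fun i => r i = false).card

/-- Total mass of the nonzero masks. -/
def totMass (p : (∀ i, α i) → ℝ) (q : Mask d → (∀ i, α i) → ℝ) : ℝ :=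
  ∑ r' ∈ univ.filter (fun r' : Mask d => r' ≠ zeroMask d), maskMarg p q r'

/-- The modeler's objective. -/
def Jobj (p : (∀ i, α i) → ℝ) (q : Mask d → (∀ i, α i) → ℝ) (θ : (∀ i, α i) → ℝ) : ℝ :=
  ∑ r : Mask d,
    if r ≠ zeroMask d ∧ 0 < maskMarg p q r then
      maskMarg p q r / totMass p q *
        ∑ xo : ∀ i : {i : Fin d // r i = true}, α i.1,
          condObs p q r xo * Real.log (obsMarg θ r xo)
    else 0

/-- Likelihood ratio of adversarial to true observed marginals. -/
def Lam (p pα : (∀ i, α i) → ℝ) (r : Mask d)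
    (xo : ∀ i : {i : Fin d // r i = true}, α i.1) : ℝ :=
  obsMarg pα r xo / obsMarg p r xo

/-- Maximum of the likelihood ratio over observed parts. -/
def LamMax (p pα : (∀ i, α i) → ℝ) (r : Mask d) : ℝ :=
  Finset.univ.sup' Finset.univ_nonempty (Lam p pα r)

/-- Generalized rejection sampling missingness mechanism with weights `w`. -/
def grs (p pα : (∀ i, α i) → ℝ) (w : Mask d → ℝ) (r : Mask d) (x : ∀ i, α i) : ℝ :=
  if r = zeroMask d then
    1 - ∑ r' ∈ univ.filter (fun r' : Mask d => r' ≠ zeroMask d),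
          w r' * Lam p pα r' (restr r' x) / LamMax p pα r'
  else w r * Lam p pα r (restr r x) / LamMax p pα r

/-- Restriction of a sample to the coordinates in a finset. -/
def restrS (S : Finset (Fin d)) (x : ∀ i, α i) : ∀ i : {i : Fin d // i ∈ S}, α i.1 :=
  fun i => x i.1

/-- Marginal pmf of the coordinates in `S`. -/
def margS (p : (∀ i, α i) → ℝ) (S : Finset (Fin d))
    (xs : ∀ i : {i : Fin d // i ∈ S}, α i.1) : ℝ :=
  ∑ x : ∀ i, α i, if restrS S x = xs then p x else 0

/-- Ratio of adversarial to true marginals on `V`. -/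
def LamV (p pα : (∀ i, α i) → ℝ) (V : Finset (Fin d))
    (xv : ∀ i : {i : Fin d // i ∈ V}, α i.1) : ℝ :=
  margS pα V xv / margS p V xv

/-- Maximum of the ratio over configurations of `V`. -/
def LamVMax (p pα : (∀ i, α i) → ℝ) (V : Finset (Fin d)) : ℝ :=
  Finset.univ.sup' Finset.univ_nonempty (LamV p pα V)

/-- Localized rejection sampling missingness mechanism on `V`. -/
def lrs (p pα : (∀ i, α i) → ℝ) (V : Finset (Fin d)) (r : Mask d) (x : ∀ i, α i) : ℝ :=
  if ∀ i ∉ V, r i = true then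
    if ∃ i ∈ V, r i = true then
      1 / ((2 : ℝ) ^ V.card - 1) * (LamV p pα V (restrS V x) / LamVMax p pα V)
    else 1 - LamV p pα V (restrS V x) / LamVMax p pα V
  else 0

/-- Conditional pmf of the complement coordinates given the `V` coordinates. -/
def condComp (p : (∀ i, α i) → ℝ) (V : Finset (Fin d))
    (xv : ∀ i : {i : Fin d // i ∈ V}, α i.1)
    (xc : ∀ i : {i : Fin d // i ∈ Vᶜ}, α i.1) : ℝ :=
  (∑ x : ∀ i, α i, if restrS V x = xv ∧ restrS Vᶜ x = xc then p x else 0) / margS p V xv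

/-- Conditional pmf of the `V` coordinates given the mask: `P(X_V = x_V | R = r)`. -/
def condV (p : (∀ i, α i) → ℝ) (q : Mask d → (∀ i, α i) → ℝ) (V : Finset (Fin d)) (r : Mask d)
    (xv : ∀ i : {i : Fin d // i ∈ V}, α i.1) : ℝ :=
  (∑ x : ∀ i, α i, if restrS V x = xv then p x * q r x else 0) / maskMarg p q r

/-- Conditional pmf of coordinate `j` given that the coordinates in `S` equal `z`. -/
def condAt (p : (∀ i, α i) → ℝ) (S : Finset (Fin d)) (j : Fin d)
    (z : ∀ i : {i : Fin d // i ∈ S}, α i.1) (a : α j) : ℝ :=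
  (∑ x : ∀ i, α i, if restrS S x = z ∧ x j = a then p x else 0) / margS p S z

/-- `p` factorizes according to the parent structure `pa`. -/
def Factorizes (p : (∀ i, α i) → ℝ) (pa : Fin d → Finset (Fin d)) : Prop :=
  ∀ x, p x = ∏ j, condAt p (pa j) j (restrS (pa j) x) (x j)

/-- KL divergence between two pmfs on a finite type. -/
def KL {β : Type*} [Fintype β] (p q : β → ℝ) : ℝ :=
  ∑ b, p b * Real.log (p b / q b)


/-- The Gibbs inequality for positive weights of equal total mass. -/
theorem sum_mul_log_le_sum_mul_log_self {β : Type*} [Fintype β] (a b : β → ℝ)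
    (ha : ∀ y, 0 < a y) (hb : ∀ y, 0 < b y) (hab : ∑ y, a y = ∑ y, b y) :
    ∑ y, a y * Real.log (b y) ≤ ∑ y, a y * Real.log (a y) := by
  have hterm : ∀ y, a y * Real.log (b y) ≤ a y * Real.log (a y) + (b y - a y) := by
    intro y
    have hlog := Real.log_le_sub_one_of_pos (div_pos (hb y) (ha y))
    rw [Real.log_div (hb y).ne' (ha y).ne'] at hlog
    have hmul := mul_le_mul_of_nonneg_left hlog (ha y).le
    have hcancel : a y * (b y / a y - 1) = b y - a y := by
      have := (ha y).ne'
      field_simp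
    linarith
  calc ∑ y, a y * Real.log (b y)
      ≤ ∑ y, (a y * Real.log (a y) + (b y - a y)) := Finset.sum_le_sum fun y _ => hterm y
    _ = ∑ y, a y * Real.log (a y) := by
      rw [Finset.sum_add_distrib, Finset.sum_sub_distrib, hab]
      ring

theorem restr_surjective (r : Mask d) : Function.Surjective (restr (α := α) r) := by
  intro xo
  refine ⟨fun i => if h : r i = true then xo ⟨i, h⟩ else Classical.arbitrary _, ?_⟩
  funext i
  simp [restr, i.2]

theorem obsMarg_pos {p : (∀ i, α i) → ℝ} (hp : ∀ x, 0 < p x) (r : Mask d)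
    (xo : ∀ i : {i : Fin d // r i = true}, α i.1) : 0 < obsMarg p r xo := by
  obtain ⟨x, hx⟩ := restr_surjective r xo
  refine Finset.sum_pos' (fun y _ => ?_) ⟨x, Finset.mem_univ x, ?_⟩
  · split_ifs
    exacts [(hp y).le, le_rfl]
  · simpa [hx] using hp x

theorem sum_obsMarg (p : (∀ i, α i) → ℝ) (r : Mask d) :
    ∑ xo, obsMarg p r xo = ∑ x, p x := by
  simp only [obsMarg]
  rw [Finset.sum_comm]
  simp

/-- Under a nonzero mask, the mechanism reweights the true observed marginal into a multiple of
the adversarial one. -/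
theorem obsMarg_mul_grs {p : (∀ i, α i) → ℝ} (hp : ∀ x, 0 < p x) (pα : (∀ i, α i) → ℝ)
    (w : Mask d → ℝ) {r : Mask d} (hr : r ≠ zeroMask d)
    (xo : ∀ i : {i : Fin d // r i = true}, α i.1) :
    obsMarg (fun x => p x * grs p pα w r x) r xo =
      w r / LamMax p pα r * obsMarg pα r xo := by
  have hne := (obsMarg_pos hp r xo).ne'
  calc obsMarg (fun x => p x * grs p pα w r x) r xo
      = obsMarg p r xo * (w r * Lam p pα r xo / LamMax p pα r) := by
        simp only [obsMarg, Finset.sum_mul]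
        refine Finset.sum_congr rfl fun x _ => ?_
        split_ifs with h
        · simp [grs, hr, h]
        · simp
    _ = w r / LamMax p pα r * (obsMarg p r xo * Lam p pα r xo) := by ring
    _ = w r / LamMax p pα r * obsMarg pα r xo := by
        rw [Lam, mul_div_cancel₀ _ hne]

theorem maskMarg_grs {p pα : (∀ i, α i) → ℝ} (hp : ∀ x, 0 < p x) (hpα_sum : ∑ x, pα x = 1)
    (w : Mask d → ℝ) {r : Mask d} (hr : r ≠ zeroMask d) :
    maskMarg p (grs p pα w) r = w r / LamMax p pα r := by
  rw [maskMarg, ← sum_obsMarg _ r]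
  simp_rw [obsMarg_mul_grs hp pα w hr]
  rw [← Finset.mul_sum, sum_obsMarg, hpα_sum, mul_one]

/-- Conditionally on a nonzero mask of positive probability, the observed part follows the
adversarial marginal. -/
theorem condObs_grs {p pα : (∀ i, α i) → ℝ} (hp : ∀ x, 0 < p x) (hpα_sum : ∑ x, pα x = 1)
    (w : Mask d → ℝ) {r : Mask d} (hr : r ≠ zeroMask d)
    (hmass : 0 < maskMarg p (grs p pα w) r)
    (xo : ∀ i : {i : Fin d // r i = true}, α i.1) :
    condObs p (grs p pα w) r xo = obsMarg pα r xo := by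
  have h := obsMarg_mul_grs hp pα w hr xo
  rw [← maskMarg_grs hp hpα_sum w hr] at h
  rw [condObs, div_eq_iff hmass.ne', mul_comm]
  exact h

/-- when the adversarial missingness mechanism is constructed by generalized
rejection sampling (with positive total nonzero-mask mass and strictly positive `p_α`),
the adversarial pmf `p_α` globally maximizes the modeler's objective. -/
theorem stmt3
    {d : ℕ} (hd : 1 ≤ d) {α : Fin d → Type*} [∀ i, Fintype (α i)] [∀ i, DecidableEq (α i)]
    [∀ i, Nonempty (α i)]
    (p pα : (∀ i, α i) → ℝ)
    (hp_pos : ∀ x, 0 < p x) (hp_sum : ∑ x, p x = 1)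
    (hpα_pos : ∀ x, 0 < pα x) (hpα_sum : ∑ x, pα x = 1)
    (w : Mask d → ℝ)
    (hw : ∀ r : Mask d, r ≠ zeroMask d → 0 ≤ w r ∧ w r ≤ 1)
    (hvalid : ∀ x : ∀ i, α i,
      ∑ r ∈ univ.filter (fun r : Mask d => r ≠ zeroMask d),
          w r * Lam p pα r (restr r x) / LamMax p pα r ≤ 1)
    (hpos : 0 < totMass p (grs p pα w))
    (θ : (∀ i, α i) → ℝ) (hθ_pos : ∀ x, 0 < θ x) (hθ_sum : ∑ x, θ x = 1) :
    Jobj p (grs p pα w) θ ≤ Jobj p (grs p pα w) pα := by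
  unfold Jobj
  refine Finset.sum_le_sum fun r _ => ?_
  split_ifs with h
  · obtain ⟨hr, hmass⟩ := h
    refine mul_le_mul_of_nonneg_left ?_ (div_pos hmass hpos).le
    simp_rw [condObs_grs hp_pos hpα_sum w hr hmass]
    refine sum_mul_log_le_sum_mul_log_self _ _ (obsMarg_pos hpα_pos r) (obsMarg_pos hθ_pos r) ?_
    rw [sum_obsMarg, sum_obsMarg, hpα_sum, hθ_sum]
  · exact le_rfl

end AM
end
end

section
/- (Optimality condition for the adversarial SCM) Let pa_p and pa_α be parent structures with pa_α j ⊆ pa_p j for all j. Let p be a strictly positive pmf factorizing according to pa_p, and let p_α be a strictly positive pmf factorizing according to pa_α. Suppose that for every j and for every strictly positive pmf q factorizing according to pa_α, Σ over configurations z of x_{pa_p j} of (p-marginal at z)·KL(p(· | x_{pa_p j} = z) ‖ p_α(· | x_{pa_p j} = z)) ≤ Σ over z of (p-marginal at z)·KL(p(· | x_{pa_p j} = z) ‖ q(· | x_{pa_p j} = z)). Then KL(p ‖ p_α) ≤ KL(p ‖ q) for every strictly positive pmf q factorizing according to pa_α. -/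
open Finset

noncomputable section

namespace AM

variable {d : ℕ} {α : Fin d → Type*} [∀ i, Fintype (α i)] [∀ i, DecidableEq (α i)]
  [∀ i, Nonempty (α i)]

/-- Summing over all resamplings of coordinate `m` counts every sample `card (α m)` times. -/
lemma sum_sum_update (m : Fin d) (f : (∀ i, α i) → ℝ) :
    ∑ x, ∑ a, f (Function.update x m a) = Fintype.card (α m) * ∑ x, f x := by
  let e : ((∀ i, α i) × α m) ≃ ((∀ i, α i) × α m) :=
    { toFun := fun t => (Function.update t.1 m t.2, t.1 m)
      invFun := fun t => (Function.update t.1 m t.2, t.1 m)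
      left_inv := fun t => by simp
      right_inv := fun t => by simp }
  rw [← Fintype.sum_prod_type' (f := fun x a => f (Function.update x m a)),
    Fintype.sum_equiv e (fun t => f (Function.update t.1 m t.2)) (fun t => f t.1) (fun _ => rfl),
    Fintype.sum_prod_type]
  simp [Finset.mul_sum]

/-- If resampling coordinate `m` turns `f` into `g`, then `f` sums to zero when `g` does. -/
lemma sum_eq_zero_of_sum_update (m : Fin d) (f g : (∀ i, α i) → ℝ)
    (hfg : ∀ x, ∑ a, f (Function.update x m a) = g x) (hg : ∑ x, g x = 0) :
    ∑ x, f x = 0 := by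
  have h := sum_sum_update m f
  simp only [hfg, hg] at h
  have hc : (Fintype.card (α m) : ℝ) ≠ 0 := by exact_mod_cast Fintype.card_ne_zero
  exact (mul_eq_zero.mp h.symm).resolve_left hc

/-- A function of the coordinates up to `j` that is conditionally centred given the coordinates
below `j` is centred under the product of the kernels `K i`. -/
lemma sum_mul_prod_kernel_eq_zero (K : Fin d → (∀ i, α i) → ℝ)
    (hK : ∀ i m, i < m → ∀ x a, K i (Function.update x m a) = K i x)
    (hK1 : ∀ i x, ∑ a, K i (Function.update x i a) = 1)
    (j : Fin d) (D : (∀ i, α i) → ℝ)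
    (hD : ∀ m, j < m → ∀ x a, D (Function.update x m a) = D x)
    (hD0 : ∀ x, ∑ a, D (Function.update x j a) * K j (Function.update x j a) = 0) :
    ∑ x, D x * ∏ i, K i x = 0 := by
  have prod_update (m : Fin d) (x : ∀ i, α i) (a : α m) :
      ∏ i ∈ univ.filter (· < m), K i (Function.update x m a)
        = ∏ i ∈ univ.filter (· < m), K i x :=
    Finset.prod_congr rfl fun i hi => hK i m (Finset.mem_filter.mp hi).2 x a
  have prod_succ (m : Fin d) (x : ∀ i, α i) :
      ∏ i ∈ univ.filter (fun i : Fin d => i.val < m.val + 1), K i x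
        = K m x * ∏ i ∈ univ.filter (· < m), K i x := by
    rw [← Finset.prod_insert (f := fun i => K i x) (by simp)]
    congr 1
    ext i
    simp only [Finset.mem_filter, Finset.mem_univ, true_and, Finset.mem_insert, Fin.ext_iff,
      Fin.lt_def]
    omega
  have key : ∀ n, j.val + 1 ≤ n → n ≤ d →
      ∑ x, D x * ∏ i ∈ univ.filter (fun i : Fin d => i.val < n), K i x = 0 := by
    intro n hn
    induction n, hn using Nat.le_induction with
    | base =>
      intro _
      refine sum_eq_zero_of_sum_update j _ (fun _ => 0) (fun x => ?_) (by simp)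
      simp only [prod_succ, prod_update, ← mul_assoc]
      rw [← Finset.sum_mul, hD0, zero_mul]
    | succ n hn ih =>
      intro hnd
      let m : Fin d := ⟨n, hnd⟩
      have hjm : j < m := hn
      refine sum_eq_zero_of_sum_update m _ _ (fun x => ?_) (ih (by omega))
      have hsucc (y : ∀ i, α i) :
          ∏ i ∈ univ.filter (fun i : Fin d => i.val < n + 1), K i y
            = K m y * ∏ i ∈ univ.filter (· < m), K i y := prod_succ m y
      simp only [hsucc, prod_update, hD m hjm]
      rw [← Finset.mul_sum, ← Finset.sum_mul, hK1, one_mul]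
      rfl
  have h := key d j.2 le_rfl
  simpa using h

lemma restrS_update_of_notMem {S : Finset (Fin d)} {m : Fin d} (hm : m ∉ S) (x : ∀ i, α i)
    (a : α m) : restrS S (Function.update x m a) = restrS S x := by
  funext i
  have : i.1 ≠ m := fun h => hm (h ▸ i.2)
  simp [restrS, this]

lemma restrS_eq_of_subset {S T : Finset (Fin d)} (hTS : T ⊆ S) {x y : ∀ i, α i}
    (h : restrS S x = restrS S y) : restrS T x = restrS T y := by
  funext i
  exact congrFun h ⟨i.1, hTS i.2⟩

lemma margS_restrS_pos {p : (∀ i, α i) → ℝ} (hp : ∀ x, 0 < p x) (S : Finset (Fin d))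
    (x : ∀ i, α i) : 0 < margS p S (restrS S x) :=
  Finset.sum_pos' (fun y _ => by split_ifs <;> simp [(hp y).le])
    ⟨x, Finset.mem_univ _, by simpa using hp x⟩

lemma margS_pos {p : (∀ i, α i) → ℝ} (hp : ∀ x, 0 < p x) (S : Finset (Fin d))
    (z : ∀ i : {i : Fin d // i ∈ S}, α i.1) : 0 < margS p S z := by
  classical
  have hz : restrS S (fun i => if h : i ∈ S then z ⟨i, h⟩ else Classical.arbitrary (α i)) = z := by
    funext i
    simp [restrS]
  rw [← hz]
  exact margS_restrS_pos hp S _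

lemma condAt_restrS_pos {p : (∀ i, α i) → ℝ} (hp : ∀ x, 0 < p x) (S : Finset (Fin d))
    (j : Fin d) (x : ∀ i, α i) : 0 < condAt p S j (restrS S x) (x j) :=
  div_pos
    (Finset.sum_pos' (fun y _ => by split_ifs <;> simp [(hp y).le])
      ⟨x, Finset.mem_univ _, by simpa using hp x⟩)
    (margS_restrS_pos hp S x)

lemma sum_condAt {p : (∀ i, α i) → ℝ} (hp : ∀ x, 0 < p x) (S : Finset (Fin d)) (j : Fin d)
    (z : ∀ i : {i : Fin d // i ∈ S}, α i.1) : ∑ a, condAt p S j z a = 1 := by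
  unfold condAt
  rw [← Finset.sum_div, div_eq_one_iff_eq (margS_pos hp S z).ne', Finset.sum_comm]
  refine Finset.sum_congr rfl fun x _ => ?_
  by_cases h : restrS S x = z <;> simp [h]

/-- Local Markov property: conditioning coordinate `j` on any set of predecessors containing its
parents is the same as conditioning on the parents. -/
lemma Factorizes.condAt_eq_of_subset {q : (∀ i, α i) → ℝ} {pa : Fin d → Finset (Fin d)}
    (hfac : Factorizes q pa) (hq : ∀ x, 0 < q x) (hpa : ∀ j, ∀ i ∈ pa j, i < j)
    {S : Finset (Fin d)} {j : Fin d} (hS : ∀ i ∈ S, i < j) (hsub : pa j ⊆ S) (y : ∀ i, α i) :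
    condAt q S j (restrS S y) (y j) = condAt q (pa j) j (restrS (pa j) y) (y j) := by
  set κ := condAt q (pa j) j (restrS (pa j) y) (y j) with hκ
  have notMem_of_le {T : Finset (Fin d)} {i m : Fin d} (hT : ∀ k ∈ T, k < i) (him : i ≤ m) :
      m ∉ T := fun h => absurd (hT m h) (not_lt.mpr him)
  have hcentred := sum_mul_prod_kernel_eq_zero
    (fun i x => condAt q (pa i) i (restrS (pa i) x) (x i))
    (fun i m him x a => by
      simp only [restrS_update_of_notMem (notMem_of_le (hpa i) him.le),
        Function.update_of_ne him.ne])
    (fun i x => by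
      simp only [restrS_update_of_notMem (notMem_of_le (hpa i) le_rfl), Function.update_self]
      exact sum_condAt hq _ _ _)
    j (fun x => if restrS S x = restrS S y then (if x j = y j then 1 else 0) - κ else 0)
    (fun m hjm x a => by
      simp only [restrS_update_of_notMem (notMem_of_le hS hjm.le), Function.update_of_ne hjm.ne])
    (fun x => by
      simp only [restrS_update_of_notMem (notMem_of_le hS le_rfl),
        restrS_update_of_notMem (notMem_of_le (hpa j) le_rfl), Function.update_self]
      by_cases h : restrS S x = restrS S y
      · simp only [h, if_true, restrS_eq_of_subset hsub h, sub_mul, Finset.sum_sub_distrib,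
          ← Finset.mul_sum, sum_condAt hq]
        simp [hκ]
      · simp [h])
  simp only [← hfac _] at hcentred
  unfold condAt
  rw [div_eq_iff (margS_restrS_pos hq S y).ne', ← sub_eq_zero, margS, Finset.mul_sum,
    ← Finset.sum_sub_distrib]
  refine Eq.trans ?_ hcentred
  refine Finset.sum_congr rfl fun x _ => ?_
  by_cases h : restrS S x = restrS S y <;> by_cases h' : x j = y j <;> simp [h, h', sub_mul]

/-- The expected conditional KL divergence as an expectation of a log-likelihood ratio. -/
lemma sum_margS_mul_KL_condAt {p : (∀ i, α i) → ℝ} (hp : ∀ x, 0 < p x) (q : (∀ i, α i) → ℝ)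
    (S : Finset (Fin d)) (j : Fin d) :
    ∑ z : ∀ i : {i : Fin d // i ∈ S}, α i.1,
        margS p S z * KL (condAt p S j z) (condAt q S j z)
      = ∑ x, p x * Real.log
          (condAt p S j (restrS S x) (x j) / condAt q S j (restrS S x) (x j)) := by
  have expand (z : ∀ i : {i : Fin d // i ∈ S}, α i.1) :
      margS p S z * KL (condAt p S j z) (condAt q S j z)
        = ∑ x, if restrS S x = z then
            p x * Real.log (condAt p S j z (x j) / condAt q S j z (x j)) else 0 := by
    have hmul (a : α j) : margS p S z * condAt p S j z a
        = ∑ x : ∀ i, α i, if restrS S x = z ∧ x j = a then p x else 0 :=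
      mul_div_cancel₀ _ (margS_pos hp S z).ne'
    simp only [KL, Finset.mul_sum, ← mul_assoc, hmul, Finset.sum_mul]
    rw [Finset.sum_comm]
    refine Finset.sum_congr rfl fun x _ => ?_
    by_cases h : restrS S x = z <;> simp [h, ite_mul]
  simp only [expand]
  rw [Finset.sum_comm]
  simp

/-- Chain rule for the KL divergence between two factorizing pmfs with nested parents. -/
lemma KL_eq_sum_condAt {p q : (∀ i, α i) → ℝ} {pap paq : Fin d → Finset (Fin d)}
    (hpap : ∀ j, ∀ i ∈ pap j, i < j) (hpaq : ∀ j, ∀ i ∈ paq j, i < j)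
    (hsub : ∀ j, paq j ⊆ pap j) (hp : ∀ x, 0 < p x) (hp_fac : Factorizes p pap)
    (hq : ∀ x, 0 < q x) (hq_fac : Factorizes q paq) :
    KL p q = ∑ j, ∑ z : ∀ i : {i : Fin d // i ∈ pap j}, α i.1,
      margS p (pap j) z * KL (condAt p (pap j) j z) (condAt q (pap j) j z) := by
  simp only [sum_margS_mul_KL_condAt hp]
  rw [Finset.sum_comm, KL]
  refine Finset.sum_congr rfl fun x _ => ?_
  rw [← Finset.mul_sum, ← Real.log_prod fun j _ =>
    (div_pos (condAt_restrS_pos hp _ j x) (condAt_restrS_pos hq _ j x)).ne',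
    Finset.prod_div_distrib, ← hp_fac x]
  simp only [hq_fac.condAt_eq_of_subset hq hpaq (hpap _) (hsub _)]
  rw [← hq_fac x]

/-- Optimality condition for the adversarial SCM: if `p_α` minimizes, for every
coordinate, the expected conditional KL divergence from `p` among SCMs factorizing according to
`pa_α`, then `p_α` minimizes the full KL divergence from `p` among such SCMs. -/
theorem stmt13
    {d : ℕ} (hd : 1 ≤ d) {α : Fin d → Type*} [∀ i, Fintype (α i)] [∀ i, DecidableEq (α i)]
    [∀ i, Nonempty (α i)]
    (pap paα : Fin d → Finset (Fin d))
    (hpap : ∀ j, ∀ i ∈ pap j, i < j) (hpaα : ∀ j, ∀ i ∈ paα j, i < j)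
    (hsub : ∀ j, paα j ⊆ pap j)
    (p : (∀ i, α i) → ℝ)
    (hp_pos : ∀ x, 0 < p x) (hp_sum : ∑ x, p x = 1) (hp_fac : Factorizes p pap)
    (pα : (∀ i, α i) → ℝ)
    (hpα_pos : ∀ x, 0 < pα x) (hpα_sum : ∑ x, pα x = 1) (hpα_fac : Factorizes pα paα)
    (hopt : ∀ j : Fin d, ∀ q : (∀ i, α i) → ℝ,
      (∀ x, 0 < q x) → (∑ x, q x = 1) → Factorizes q paα →
      ∑ z : ∀ i : {i : Fin d // i ∈ pap j}, α i.1,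
          margS p (pap j) z * KL (condAt p (pap j) j z) (condAt pα (pap j) j z)
        ≤ ∑ z : ∀ i : {i : Fin d // i ∈ pap j}, α i.1,
            margS p (pap j) z * KL (condAt p (pap j) j z) (condAt q (pap j) j z)) :
    ∀ q : (∀ i, α i) → ℝ, (∀ x, 0 < q x) → (∑ x, q x = 1) → Factorizes q paα →
      KL p pα ≤ KL p q := by
  intro q hq hq_sum hq_fac
  rw [KL_eq_sum_condAt hpap hpaα hsub hp_pos hp_fac hpα_pos hpα_fac,
    KL_eq_sum_condAt hpap hpaα hsub hp_pos hp_fac hq hq_fac]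
  exact Finset.sum_le_sum fun j _ => hopt j q hq hq_sum hq_fac

end AM
end
end
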